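/- arXiv:1412.8756 — 2 statements merged into one kernel-verified Lean document; each statement's English description precedes it below -/
import Mathlib

section
/- Define a sequence of functions u_p : ℝ × ℝ × ℝ → ℝ by u₀(x,y,t) = t²·(x² + y²) and, for p ≥ 1, u_p(x,y,t) = t²·(x² + y²) + (15/2)·∫₀ᵗ (t - ξ)·( x·(∂²u_{p-1}/∂x²(x,y,ξ))² + y·(∂²u_{p-1}/∂y²(x,y,ξ))² ) dξ. Then for every integer p ≥ 1 and all (x,y,t): u_p(x,y,t) = t²·(x² + y²) + t⁶·(x + y). -/
theorem iteratedDeriv_two_quadratic (a b c x : ℝ) :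
    iteratedDeriv 2 (fun z => a * z ^ 2 + b * z + c) x = 2 * a := by
  have h₁ : deriv (fun z : ℝ => a * z ^ 2 + b * z + c) = fun z => 2 * a * z + b := by
    ext z
    have h := ((((hasDerivAt_id' z).pow 2).const_mul a).add
      ((hasDerivAt_id' z).const_mul b)).add_const c
    exact (h.congr_deriv (by simp; ring)).deriv
  rw [iteratedDeriv_succ, iteratedDeriv_one, h₁]
  exact ((((hasDerivAt_id' x).const_mul (2 * a)).add_const b).congr_deriv (mul_one _)).deriv

theorem integral_sub_mul_pow_four (c t : ℝ) :
    ∫ ξ in (0 : ℝ)..t, (t - ξ) * (c * ξ ^ 4) = c * t ^ 6 / 30 := by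
  have h (ξ : ℝ) : (t - ξ) * (c * ξ ^ 4) = c * t * ξ ^ 4 - c * ξ ^ 5 := by ring
  simp only [h]
  rw [intervalIntegral.integral_sub
    (Continuous.intervalIntegrable (by fun_prop) _ _)
    (Continuous.intervalIntegrable (by fun_prop) _ _)]
  simp only [intervalIntegral.integral_const_mul, integral_pow]
  norm_num
  ring


/-- Example 3, iterative scheme: `u₀(x,y,t) = t²·(x²+y²)`,
`u_{p+1} = t²(x²+y²) + (15/2)·∫₀ᵗ (t-ξ)·(x(∂²u_p/∂x²)² + y(∂²u_p/∂y²)²) dξ`.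
Then every iterate `u_p`, `p ≥ 1`, equals `t²·(x²+y²) + t⁶·(x+y)`. -/
theorem stmt_11 (u : ℕ → ℝ → ℝ → ℝ → ℝ)
    (hu0 : ∀ x y t : ℝ, u 0 x y t = t ^ 2 * (x ^ 2 + y ^ 2))
    (hup : ∀ p : ℕ, ∀ x y t : ℝ, u (p + 1) x y t = t ^ 2 * (x ^ 2 + y ^ 2) +
      15 / 2 * ∫ ξ in (0 : ℝ)..t, (t - ξ) *
        (x * (iteratedDeriv 2 (fun x' => u p x' y ξ) x) ^ 2
          + y * (iteratedDeriv 2 (fun y' => u p x y' ξ) y) ^ 2)) :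
    ∀ p : ℕ, 1 ≤ p → ∀ x y t : ℝ,
      u p x y t = t ^ 2 * (x ^ 2 + y ^ 2) + t ^ 6 * (x + y) := by
  have step (p : ℕ) (k : ℝ) (hp : ∀ x y t : ℝ,
      u p x y t = t ^ 2 * (x ^ 2 + y ^ 2) + k * t ^ 6 * (x + y)) (x y t : ℝ) :
      u (p + 1) x y t = t ^ 2 * (x ^ 2 + y ^ 2) + t ^ 6 * (x + y) := by
    have hx (ξ : ℝ) : iteratedDeriv 2 (fun x' => u p x' y ξ) x = 2 * ξ ^ 2 := by
      rw [← iteratedDeriv_two_quadratic _ (k * ξ ^ 6) (ξ ^ 2 * y ^ 2 + k * ξ ^ 6 * y) x]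
      congr 1
      ext z
      rw [hp]
      ring
    have hy (ξ : ℝ) : iteratedDeriv 2 (fun y' => u p x y' ξ) y = 2 * ξ ^ 2 := by
      rw [← iteratedDeriv_two_quadratic _ (k * ξ ^ 6) (ξ ^ 2 * x ^ 2 + k * ξ ^ 6 * x) y]
      congr 1
      ext z
      rw [hp]
      ring
    have hi (ξ : ℝ) : x * (2 * ξ ^ 2) ^ 2 + y * (2 * ξ ^ 2) ^ 2 = 4 * (x + y) * ξ ^ 4 := by
      ring
    rw [hup]
    simp only [hx, hy, hi, integral_sub_mul_pow_four]
    ring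
  intro p hp
  induction p, hp using Nat.le_induction with
  | base => exact step 0 0 (by simpa using hu0)
  | succ p _ ih => exact step p 1 (by simpa using ih)
end

section
/- Define a sequence of functions u_k : ℝ × ℝ × ℝ × ℝ → ℝ by u₀(x,y,z,t) = t·(x² + y² - z²) + (t²/2)·(x² + y² + z²) and, for k ≥ 1, u_k(x,y,z,t) = u₀(x,y,z,t) + (1/2)·∫₀ᵗ (t - ξ)·( x²·∂²u_{k-1}/∂x²(x,y,z,ξ) + y²·∂²u_{k-1}/∂y²(x,y,z,ξ) + z²·∂²u_{k-1}/∂z²(x,y,z,ξ) ) dξ. Then for every integer k ≥ 0 and all (x,y,z,t): u_k(x,y,z,t) = (x² + y²)·Σ_{j=1}^{2k+2} t^j/j! + z²·Σ_{j=1}^{2k+2} (-1)^j·t^j/j!. -/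
theorem iteratedDeriv_two_sq_mul_add (a b x : ℝ) :
    iteratedDeriv 2 (fun s : ℝ => s ^ 2 * a + b) x = 2 * a := by
  have h : deriv (fun s : ℝ => s ^ 2 * a + b) = fun s => 2 * a * s := by
    funext s
    have := (((hasDerivAt_id s).pow 2).mul_const a).add_const b
    refine HasDerivAt.deriv (this.congr_deriv ?_)
    simp
    ring
  rw [iteratedDeriv_succ, iteratedDeriv_one, h]
  simp

theorem integral_sub_mul_pow_div_factorial (t : ℝ) (j : ℕ) :
    ∫ s in (0 : ℝ)..t, (t - s) * (s ^ j / (Nat.factorial j : ℝ)) =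
      t ^ (j + 2) / (Nat.factorial (j + 2) : ℝ) := by
  have h : ∀ s : ℝ, (t - s) * (s ^ j / (Nat.factorial j : ℝ)) =
      t / (Nat.factorial j : ℝ) * s ^ j - 1 / (Nat.factorial j : ℝ) * s ^ (j + 1) := by
    intro s
    ring
  simp_rw [h]
  rw [intervalIntegral.integral_sub
    (Continuous.intervalIntegrable (by fun_prop) _ _)
    (Continuous.intervalIntegrable (by fun_prop) _ _),
    intervalIntegral.integral_const_mul, intervalIntegral.integral_const_mul,
    integral_pow, integral_pow]
  have hj : (Nat.factorial j : ℝ) ≠ 0 := by positivity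
  have h1 : (j : ℝ) + 1 ≠ 0 := by positivity
  have h2 : (j : ℝ) + 1 + 1 ≠ 0 := by positivity
  simp only [Nat.factorial_succ]
  push_cast
  field_simp
  ring

/-- The Taylor polynomial of `exp (c * t) - 1` of degree `n`. -/
noncomputable def expTaylorSum (c : ℝ) (n : ℕ) (t : ℝ) : ℝ :=
  ∑ j ∈ Finset.Icc 1 n, c ^ j * t ^ j / (Nat.factorial j : ℝ)

theorem continuous_expTaylorSum (c : ℝ) (n : ℕ) : Continuous (expTaylorSum c n) := by
  unfold expTaylorSum
  fun_prop

theorem expTaylorSum_succ (c : ℝ) (n : ℕ) (t : ℝ) :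
    expTaylorSum c (n + 1) t =
      expTaylorSum c n t + c ^ (n + 1) * t ^ (n + 1) / (Nat.factorial (n + 1) : ℝ) :=
  Finset.sum_Icc_succ_top (by omega) _

theorem expTaylorSum_two (c t : ℝ) : expTaylorSum c 2 t = c * t + c ^ 2 * (t ^ 2 / 2) := by
  rw [expTaylorSum_succ, expTaylorSum_succ]
  simp [expTaylorSum]
  ring

theorem expTaylorSum_add_two (c : ℝ) (n : ℕ) (t : ℝ) :
    expTaylorSum c (n + 2) t = c * t + c ^ 2 * (t ^ 2 / 2) +
      c ^ 2 * ∫ s in (0 : ℝ)..t, (t - s) * expTaylorSum c n s := by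
  induction n with
  | zero => simpa [expTaylorSum] using expTaylorSum_two c t
  | succ n ih =>
    have h : ∀ s : ℝ, (t - s) * expTaylorSum c (n + 1) s =
        (t - s) * expTaylorSum c n s +
          c ^ (n + 1) * ((t - s) * (s ^ (n + 1) / (Nat.factorial (n + 1) : ℝ))) := by
      intro s
      rw [expTaylorSum_succ]
      ring
    have hc := continuous_expTaylorSum c n
    simp_rw [h]
    rw [intervalIntegral.integral_add
      (Continuous.intervalIntegrable (by fun_prop) _ _)
      (Continuous.intervalIntegrable (by fun_prop) _ _),
      intervalIntegral.integral_const_mul, integral_sub_mul_pow_div_factorial,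
      show n + 1 + 2 = n + 2 + 1 by omega, expTaylorSum_succ, ih]
    ring

/-- Example 4, iterative scheme: `u₀ = t(x²+y²-z²) + (t²/2)(x²+y²+z²)`,
`u_{k+1} = u₀ + (1/2)∫₀ᵗ (t-ξ)(x²∂²u_k/∂x² + y²∂²u_k/∂y² + z²∂²u_k/∂z²) dξ`. Then
`u_k = (x²+y²)·∑_{j=1}^{2k+2} t^j/j! + z²·∑_{j=1}^{2k+2} (-1)^j t^j/j!` for all `k ≥ 0`. -/
theorem stmt_13 (u : ℕ → ℝ → ℝ → ℝ → ℝ → ℝ)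
    (hu0 : ∀ x y z t : ℝ, u 0 x y z t =
      t * (x ^ 2 + y ^ 2 - z ^ 2) + t ^ 2 / 2 * (x ^ 2 + y ^ 2 + z ^ 2))
    (huk : ∀ k : ℕ, ∀ x y z t : ℝ, u (k + 1) x y z t = u 0 x y z t +
      1 / 2 * ∫ ξ in (0 : ℝ)..t, (t - ξ) *
        (x ^ 2 * iteratedDeriv 2 (fun x' => u k x' y z ξ) x
          + y ^ 2 * iteratedDeriv 2 (fun y' => u k x y' z ξ) y
          + z ^ 2 * iteratedDeriv 2 (fun z' => u k x y z' ξ) z)) :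
    ∀ k : ℕ, ∀ x y z t : ℝ,
      u k x y z t =
        (x ^ 2 + y ^ 2) * (∑ j ∈ Finset.Icc 1 (2 * k + 2), t ^ j / (Nat.factorial j : ℝ))
        + z ^ 2 * (∑ j ∈ Finset.Icc 1 (2 * k + 2),
            (-1 : ℝ) ^ j * t ^ j / (Nat.factorial j : ℝ)) := by
  suffices h : ∀ k : ℕ, ∀ x y z t : ℝ, u k x y z t =
      (x ^ 2 + y ^ 2) * expTaylorSum 1 (2 * k + 2) t +
        z ^ 2 * expTaylorSum (-1) (2 * k + 2) t by
    simpa [expTaylorSum] using h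
  intro k
  induction k with
  | zero =>
    intro x y z t
    rw [hu0, mul_zero, zero_add, expTaylorSum_two, expTaylorSum_two]
    ring
  | succ k ih =>
    intro x y z t
    set A := expTaylorSum 1 (2 * k + 2) with hA
    set B := expTaylorSum (-1) (2 * k + 2) with hB
    have hcA : Continuous A := continuous_expTaylorSum _ _
    have hcB : Continuous B := continuous_expTaylorSum _ _
    have hx : ∀ s, iteratedDeriv 2 (fun x' => u k x' y z s) x = 2 * A s := by
      intro s
      rw [← iteratedDeriv_two_sq_mul_add (A s) (y ^ 2 * A s + z ^ 2 * B s) x]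
      congr 1
      funext w
      rw [ih]
      ring
    have hy : ∀ s, iteratedDeriv 2 (fun y' => u k x y' z s) y = 2 * A s := by
      intro s
      rw [← iteratedDeriv_two_sq_mul_add (A s) (x ^ 2 * A s + z ^ 2 * B s) y]
      congr 1
      funext w
      rw [ih]
      ring
    have hz : ∀ s, iteratedDeriv 2 (fun z' => u k x y z' s) z = 2 * B s := by
      intro s
      rw [← iteratedDeriv_two_sq_mul_add (B s) ((x ^ 2 + y ^ 2) * A s) z]
      congr 1
      funext w
      rw [ih]
      ring
    have hint : ∀ s, (t - s) * (x ^ 2 * (2 * A s) + y ^ 2 * (2 * A s) + z ^ 2 * (2 * B s)) =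
        2 * (x ^ 2 + y ^ 2) * ((t - s) * A s) + 2 * z ^ 2 * ((t - s) * B s) := by
      intro s
      ring
    rw [huk, hu0]
    simp_rw [hx, hy, hz, hint]
    rw [intervalIntegral.integral_add
      (Continuous.intervalIntegrable (by fun_prop) _ _)
      (Continuous.intervalIntegrable (by fun_prop) _ _),
      intervalIntegral.integral_const_mul, intervalIntegral.integral_const_mul,
      show 2 * (k + 1) + 2 = 2 * k + 2 + 2 by omega,
      expTaylorSum_add_two, expTaylorSum_add_two, ← hA, ← hB]
    ring
end
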